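/- (Correctability of an algebra implies the mirrored logical operators commute with the reference–environment density matrix.) Let M be a star-subalgebra of Matrix (Fin k) (Fin k) ℂ containing the identity. Define φ : Fin k × A × Ā → ℂ by φ (i, a, b) = (1 / √k) * v i (a, b) and ρ_{RĀ} : Matrix (Fin k × Ā) (Fin k × Ā) ℂ by ρ_{RĀ} (i,b) (i',b') = Σ_a φ (i,a,b) * conj (φ (i',a,b')). Suppose that for every X : Matrix Ā Ā ℂ there exists x' in the commutant of M such that P * (1 ⊗ₖ X) * P = Σ_{i,j} (x' j i) • E j i, where E j i has entries E z z' = v j z * conj (v i z'). Then for every o ∈ M, the matrix O_R : Matrix (Fin k × Ā) (Fin k × Ā) ℂ defined by O_R (i,b) (i',b') = (if b = b' then o i' i else 0) (the transpose of o acting on the reference factor) commutes with ρ_{RĀ}: O_R * ρ_{RĀ} = ρ_{RĀ} * O_R. -/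

import Mathlib

open Matrix Kronecker

/-- The projection onto the code subspace spanned by the family `v`:
`P z z' = Σ_i v i z * conj (v i z')`. -/
noncomputable def codeProj {A B : Type*} [Fintype A] [Fintype B] {k : ℕ}
    (v : Fin k → A × B → ℂ) : Matrix (A × B) (A × B) ℂ :=
  Matrix.of fun z z' => ∑ i, v i z * (starRingEnd ℂ) (v i z')

/-- The purifying state `φ (i, a, b) = (1/√k) * v i (a, b)` on `R × A × Ā`. -/
noncomputable def purifyingState {A B : Type*} {k : ℕ} (v : Fin k → A × B → ℂ) :
    Fin k × A × B → ℂ :=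
  fun z => (1 / (Real.sqrt k : ℂ)) * v z.1 (z.2.1, z.2.2)

/-- The reduced density matrix `ρ_{RĀ}` of the purifying state `φ`. -/
noncomputable def rhoRAbar {A B : Type*} [Fintype A] {k : ℕ} (v : Fin k → A × B → ℂ) :
    Matrix (Fin k × B) (Fin k × B) ℂ :=
  Matrix.of fun z z' => ∑ a,
    purifyingState v (z.1, a, z.2) * (starRingEnd ℂ) (purifyingState v (z'.1, a, z'.2))

/-- The matrix whose columns are the vectors of the family `v`. -/
def codeIsometry {Z : Type*} {k : ℕ} (v : Fin k → Z → ℂ) : Matrix Z (Fin k) ℂ :=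
  Matrix.of fun z i => v i z

theorem codeProj_eq_mul_conjTranspose {A B : Type*} [Fintype A] [Fintype B] {k : ℕ}
    (v : Fin k → A × B → ℂ) :
    codeProj v = codeIsometry v * (codeIsometry v)ᴴ := by
  ext z z'
  simp [codeProj, codeIsometry, Matrix.mul_apply]

theorem conjTranspose_codeIsometry_mul_self {Z : Type*} [Fintype Z] {k : ℕ}
    {v : Fin k → Z → ℂ}
    (hv : ∀ i j, (∑ z, (starRingEnd ℂ) (v i z) * v j z) = if i = j then 1 else 0) :
    (codeIsometry v)ᴴ * codeIsometry v = 1 := by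
  ext i j
  simpa [codeIsometry, Matrix.mul_apply, Matrix.one_apply] using hv i j

theorem sum_smul_ketBra_eq {Z : Type*} {k : ℕ} (v : Fin k → Z → ℂ)
    (x : Matrix (Fin k) (Fin k) ℂ) :
    (∑ i, ∑ j, x j i • (Matrix.of fun z z' => v j z * (starRingEnd ℂ) (v i z')) :
        Matrix Z Z ℂ) = codeIsometry v * x * (codeIsometry v)ᴴ := by
  ext z z'
  simp only [Matrix.sum_apply, Matrix.smul_apply, Matrix.of_apply, Matrix.mul_apply,
    codeIsometry, Matrix.conjTranspose_apply, Finset.sum_mul, smul_eq_mul, starRingEnd_apply]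
  refine Finset.sum_congr rfl fun i _ => Finset.sum_congr rfl fun j _ => ?_
  ring

/-- An operator on the code subspace is determined by its compression. -/
theorem compression_eq_of_codeProj_mul_mul {A B : Type*} [Fintype A] [Fintype B] {k : ℕ}
    {v : Fin k → A × B → ℂ}
    (hv : ∀ i j, (∑ z, (starRingEnd ℂ) (v i z) * v j z) = if i = j then 1 else 0)
    {T : Matrix (A × B) (A × B) ℂ} {x : Matrix (Fin k) (Fin k) ℂ}
    (h : codeProj v * T * codeProj v = codeIsometry v * x * (codeIsometry v)ᴴ) :
    (codeIsometry v)ᴴ * T * codeIsometry v = x := by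
  have hV := conjTranspose_codeIsometry_mul_self hv
  rw [codeProj_eq_mul_conjTranspose] at h
  generalize codeIsometry v = V at h hV ⊢
  calc Vᴴ * T * V = (Vᴴ * V) * (Vᴴ * T * V) * (Vᴴ * V) := by simp [hV]
    _ = Vᴴ * (V * Vᴴ * T * (V * Vᴴ)) * V := by simp only [Matrix.mul_assoc]
    _ = (Vᴴ * V) * x * (Vᴴ * V) := by rw [h]; simp only [Matrix.mul_assoc]
    _ = x := by simp [hV]

/-- The entries of `ρ_{RĀ}` are, up to normalization, the matrix elements between code vectors
of the matrix units acting on `Ā`. -/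
theorem rhoRAbar_apply_eq_compression_single {A B : Type*} [Fintype A] [DecidableEq A]
    [Fintype B] [DecidableEq B] {k : ℕ} (v : Fin k → A × B → ℂ) (i j : Fin k) (b c : B) :
    rhoRAbar v (i, b) (j, c) =
      (1 / (Real.sqrt k : ℂ)) * (starRingEnd ℂ) (1 / (Real.sqrt k : ℂ)) *
        ((codeIsometry v)ᴴ * ((1 : Matrix A A ℂ) ⊗ₖ Matrix.single c b 1) *
          codeIsometry v : Matrix (Fin k) (Fin k) ℂ) j i := by
  have hcomp : ((codeIsometry v)ᴴ * ((1 : Matrix A A ℂ) ⊗ₖ Matrix.single c b 1) *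
      codeIsometry v : Matrix (Fin k) (Fin k) ℂ) j i = ∑ a, v i (a, b) * (starRingEnd ℂ) (v j (a, c)) := by
    simp [Matrix.mul_apply, codeIsometry, Fintype.sum_prod_type, Matrix.one_apply,
      Matrix.single_apply, ite_and, mul_comm]
  rw [hcomp, Finset.mul_sum]
  simp only [rhoRAbar, purifyingState, Matrix.of_apply, map_mul]
  refine Finset.sum_congr rfl fun a _ => ?_
  ring

/-- **Correctability of an algebra implies the mirrored logical operators commute with the
reference–environment density matrix**: if for every `X` supported on `Ā` the operator
`P * X * P` acts within the code subspace as an element of the commutant of `M`, then for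
every `o ∈ M` the operator `O_R` (the transpose of `o` acting on the reference factor)
commutes with `ρ_{RĀ}`. -/
theorem correctable_algebra_commutes_with_rhoRAbar {A B : Type*}
    [Fintype A] [DecidableEq A] [Nonempty A] [Fintype B] [DecidableEq B] [Nonempty B]
    {k : ℕ} (hk : 0 < k) (v : Fin k → A × B → ℂ)
    (hv : ∀ i j, (∑ z, (starRingEnd ℂ) (v i z) * v j z) = if i = j then 1 else 0)
    (M : StarSubalgebra ℂ (Matrix (Fin k) (Fin k) ℂ))
    (h3 : ∀ X : Matrix B B ℂ, ∃ x' : Matrix (Fin k) (Fin k) ℂ,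
      (∀ m ∈ M, x' * m = m * x') ∧
      codeProj v * ((1 : Matrix A A ℂ) ⊗ₖ X) * codeProj v =
        ∑ i, ∑ j, x' j i •
          (Matrix.of fun z z' => v j z * (starRingEnd ℂ) (v i z'))) :
    ∀ o ∈ M,
      (Matrix.of fun z z' : Fin k × B =>
          if z.2 = z'.2 then o z'.1 z.1 else 0) * rhoRAbar v =
      rhoRAbar v *
        (Matrix.of fun z z' : Fin k × B => if z.2 = z'.2 then o z'.1 z.1 else 0) := by
  intro o ho
  ext ⟨i, b⟩ ⟨j, c⟩
  obtain ⟨x, hcomm, hx⟩ := h3 (Matrix.single c b 1)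
  rw [sum_smul_ketBra_eq] at hx
  have hrho : ∀ i j, rhoRAbar v (i, b) (j, c) =
      (1 / (Real.sqrt k : ℂ)) * (starRingEnd ℂ) (1 / (Real.sqrt k : ℂ)) * x j i := fun i j => by
    rw [rhoRAbar_apply_eq_compression_single, compression_eq_of_codeProj_mul_mul hv hx]
  have hentry := congrFun (congrFun (hcomm o ho) j) i
  simp only [Matrix.mul_apply] at hentry
  simp only [Matrix.mul_apply, Fintype.sum_prod_type, Matrix.of_apply, ite_mul, zero_mul,
    mul_ite, mul_zero, Finset.sum_ite_eq, Finset.sum_ite_eq', Finset.mem_univ, if_true, hrho]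
  generalize (1 / (Real.sqrt k : ℂ)) * (starRingEnd ℂ) (1 / (Real.sqrt k : ℂ)) = r
  calc ∑ l, o l i * (r * x j l) = r * ∑ l, x j l * o l i := by
        rw [Finset.mul_sum]
        exact Finset.sum_congr rfl fun l _ => by ring
    _ = ∑ l, r * x l i * o j l := by
        rw [hentry, Finset.mul_sum]
        exact Finset.sum_congr rfl fun l _ => by ring
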